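/- The cardinality of the double coset K_λ of the hyperoctahedral group B_n in S_{2n} equals |B_n|² / (2^{ℓ(λ)} z_λ) = (2^n n!)² / (2^{ℓ(λ)} z_λ), where K_λ consists of all ω ∈ S_{2n} such that f⋆ ∘ ω ∘ f⋆ ∘ ω^{−1} has cycle type (λ_1, λ_1, λ_2, λ_2, ..., λ_p, λ_p). -/

import Mathlib

/-- The underlying function of `f⋆ = (1 2)(3 4) ⋯ (2n-1 2n)` on `Fin (2n)`
(0-indexed: it exchanges `2i` and `2i+1` for each `i < n`). -/
def fstarFun (n : ℕ) : Fin (2 * n) → Fin (2 * n) := fun k =>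
  ⟨if k.1 % 2 = 0 then k.1 + 1 else k.1 - 1, by
    obtain ⟨k, hk⟩ := k; dsimp only; split <;> omega⟩

lemma fstarFun_involutive (n : ℕ) : Function.Involutive (fstarFun n) := by
  intro k
  obtain ⟨k, hk⟩ := k
  simp only [fstarFun]
  apply Fin.ext
  dsimp only
  split_ifs <;> omega

/-- The fixed-point-free involution `f⋆ = (1 2)(3 4) ⋯ (2n-1 2n) ∈ S_{2n}`. -/
def fstar (n : ℕ) : Equiv.Perm (Fin (2 * n)) := (fstarFun_involutive n).toPerm

/-- `z_λ = ∏_i i^{m_i(λ)} m_i(λ)!` for a multiset of parts `λ`. -/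
def zPart (M : Multiset ℕ) : ℕ :=
  M.toFinset.prod fun i => i ^ M.count i * Nat.factorial (M.count i)

namespace KLam
open Equiv Equiv.Perm

/-- block-diagonal permutation -/
def D {α : Type*} (p : Bool → Perm α) : Perm (α × Bool) := Equiv.prodCongrLeft p

lemma D_apply {α : Type*} (p : Bool → Perm α) (x : α) (c : Bool) : D p (x, c) = (p c x, c) := rfl

lemma D_mul {α : Type*} (p q : Bool → Perm α) : D p * D q = D (fun c => p c * q c) := by
  ext ⟨x, c⟩ <;> rfl

lemma D_inv {α : Type*} (p : Bool → Perm α) : (D p)⁻¹ = D (fun c => (p c)⁻¹) := by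
  rw [inv_eq_iff_mul_eq_one, D_mul]
  ext ⟨x, c⟩ <;> simp [D_apply]

lemma D_inj {α : Type*} : Function.Injective (D (α := α)) := by
  intro p q h
  funext c
  ext x
  have := congrArg (fun e => (e (x, c)).1) h
  simpa [D_apply] using this

lemma cycleType_D_one {α : Type*} [Fintype α] [DecidableEq α] (c : Bool) (a : Perm α) :
    (D (fun d => if d = c then a else 1)).cycleType = a.cycleType := by
  let e : α ≃ {y : α × Bool // y.2 = c} :=
    { toFun := fun x => ⟨(x, c), rfl⟩
      invFun := fun y => y.1.1
      left_inv := fun x => rfl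
      right_inv := fun y => by
        obtain ⟨⟨x, d⟩, h⟩ := y
        cases h; rfl }
  rw [← cycleType_extendDomain e (g := a)]
  congr 1
  ext1 ⟨x, d⟩
  by_cases h : d = c
  · subst h
    have := Perm.extendDomain_apply_image a e x
    simp only [e, Equiv.coe_fn_mk] at this
    rw [this, D_apply]; simp
  · rw [Perm.extendDomain_apply_not_subtype _ _ (by simpa using h), D_apply]
    simp [h]

lemma cycleType_D {α : Type*} [Fintype α] [DecidableEq α] (p : Bool → Perm α) :
    (D p).cycleType = (p true).cycleType + (p false).cycleType := by
  rw [← cycleType_D_one true (p true), ← cycleType_D_one false (p false), ← Disjoint.cycleType_mul]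
  · rw [D_mul]
    congr 2
    funext c
    cases c <;> simp
  · rintro ⟨x, c⟩
    cases c <;> simp [D_apply]

lemma exists_D {α : Type*} [Finite α] (w : Perm (α × Bool)) (h : ∀ y, (w y).2 = y.2) :
    ∃ p, D p = w := by
  have inj : ∀ c, Function.Injective (fun x : α => (w (x, c)).1) := by
    intro c x x' hx
    have : w (x, c) = w (x', c) := Prod.ext hx (by rw [h, h])
    exact (Prod.ext_iff.1 (w.injective this)).1
  refine ⟨fun c => Equiv.ofBijective _ (Finite.injective_iff_bijective.1 (inj c)), ?_⟩
  ext1 ⟨x, c⟩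
  rw [D_apply]
  exact Prod.ext rfl (h (x, c)).symm

lemma pp_inv {α : Type*} (w : Perm α) (x : α) : w (w⁻¹ x) = x := by simp

/-- flip -/
def F (α : Type*) : Perm (α × Bool) := Equiv.prodCongr (Equiv.refl α) Equiv.boolNot

lemma F_apply {α : Type*} (x : α) (c : Bool) : F α (x, c) = (x, !c) := rfl

lemma F_mul_F {α : Type*} : F α * F α = 1 := by
  ext ⟨x, c⟩ <;> simp [F_apply]

lemma F_D {α : Type*} [Fintype α] [DecidableEq α] (p : Bool → Perm α) :
    (F α * D p * F α * (D p)⁻¹).cycleType =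
      (p true * (p false)⁻¹).cycleType + (p true * (p false)⁻¹).cycleType := by
  have : F α * D p * F α * (D p)⁻¹ = D (fun c => p (!c) * (p c)⁻¹) := by
    rw [D_inv]
    ext1 ⟨x, c⟩
    simp [F_apply, D_apply]
  rw [this, cycleType_D, ← cycleType_inv (p (!true) * _)]
  simp

/-- Colourings compatible with a fixed-point-free involution. -/
lemma card_colour {Q : Type*} [Finite Q] (i : Q → Q) (hi : ∀ x, i (i x) = x) (hf : ∀ x, i x ≠ x) :
    ∃ r, Nat.card Q = 2 * r ∧ Nat.card {S : Q → Bool // ∀ x, S (i x) = !S x} = 2 ^ r := by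
  classical
  obtain ⟨m, ⟨e⟩⟩ := Finite.exists_equiv_fin Q
  let R := {x : Q // e x < e (i x)}
  have key : ∀ x, ¬ e x < e (i x) → e (i x) < e (i (i x)) := by
    intro x h
    rw [hi]
    exact lt_of_le_of_ne (not_lt.1 h) (fun h' => hf x (e.injective h'))
  refine ⟨Nat.card R, ?_, ?_⟩
  · have E : Q ≃ R × Bool :=
      { toFun := fun x => if h : e x < e (i x) then (⟨x, h⟩, true) else (⟨i x, key x h⟩, false)
        invFun := fun y => if y.2 then y.1.1 else i y.1.1
        left_inv := by
          intro x
          dsimp only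
          split_ifs <;> simp_all
        right_inv := by
          rintro ⟨⟨x, hx⟩, c⟩
          cases c
          · have : ¬ e (i x) < e (i (i x)) := by rw [hi]; exact not_lt.2 hx.le
            simp only [Bool.false_eq_true, if_false]
            rw [dif_neg this]
            simp [hi]
          · simp [hx] }
    rw [Nat.card_congr E, Nat.card_prod]; simp [mul_comm]
  · have E : {S : Q → Bool // ∀ x, S (i x) = !S x} ≃ (R → Bool) :=
      { toFun := fun S r => S.1 r.1
        invFun := fun T => ⟨fun x => if h : e x < e (i x) then T ⟨x, h⟩ else !T ⟨i x, key x h⟩, by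
          intro x
          dsimp only
          by_cases h : e x < e (i x)
          · have h' : ¬ e (i x) < e (i (i x)) := by rw [hi]; exact not_lt.2 h.le
            rw [dif_pos h, dif_neg h']
            simp [hi]
          · rw [dif_pos (key x h), dif_neg h]; simp⟩
        left_inv := by
          rintro ⟨S, hS⟩
          apply Subtype.ext
          funext x
          dsimp only
          split_ifs <;> simp [hS]
        right_inv := by
          intro T
          funext ⟨x, hx⟩
          simp [hx] }
    rw [Nat.card_congr E, Nat.card_fun]; simp

lemma card_cycles {α : Type*} [Fintype α] [DecidableEq α] (σ : Perm α) :
    Nat.card (Quotient (SameCycle.setoid σ)) = σ.partition.parts.card := by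
  have hx : ∀ c : σ.cycleFactorsFinset, ∃ x, x ∈ (c : Perm α).support := fun c =>
    (mem_cycleFactorsFinset_iff.1 c.2).1.nonempty_support
  choose g hg using hx
  have hc : ∀ c : σ.cycleFactorsFinset, (c : Perm α) = σ.cycleOf (g c) := fun c => cycle_is_cycleOf (hg c) c.2
  have hsup : ∀ c, g c ∈ σ.support := fun c => mem_cycleFactorsFinset_support_le c.2 (hg c)
  let φ : σ.cycleFactorsFinset ⊕ {x // x ∉ σ.support} → Quotient (SameCycle.setoid σ) :=
    Sum.elim (fun c => Quotient.mk _ (g c)) (fun x => Quotient.mk _ x.1)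
  have hφ : Function.Bijective φ := by
    constructor
    · rintro (c | ⟨x, hx⟩) (d | ⟨y, hy⟩) h
      · have h : σ.SameCycle (g c) (g d) := Quotient.exact h
        congr 1
        apply Subtype.ext
        rw [hc c, hc d, h.cycleOf_eq]
      · have h : σ.SameCycle (g c) y := Quotient.exact h
        exfalso
        have hy : σ y = y := by simpa using hy
        have := hsup c
        rw [mem_support] at this
        exact this (h.apply_eq_self_iff.2 hy)
      · have h : σ.SameCycle x (g d) := Quotient.exact h
        exfalso
        have hx : σ x = x := by simpa using hx
        have := hsup d
        rw [mem_support] at this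
        exact this (h.apply_eq_self_iff.1 hx)
      · have h : σ.SameCycle x y := Quotient.exact h
        have hx : σ x = x := by simpa using hx
        have := h.eq_of_left hx
        subst this; rfl
    · intro q
      induction q using Quotient.inductionOn with
      | h x =>
        by_cases hx : x ∈ σ.support
        · let c : σ.cycleFactorsFinset := ⟨σ.cycleOf x, cycleOf_mem_cycleFactorsFinset_iff.2 hx⟩
          refine ⟨Sum.inl c, Quotient.sound ?_⟩
          have := hg c
          rw [mem_support_cycleOf_iff] at this
          exact this.1.symm
        · exact ⟨Sum.inr ⟨x, hx⟩, rfl⟩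
  rw [← Nat.card_congr (Equiv.ofBijective φ hφ), Nat.card_sum, parts_partition]
  rw [Multiset.card_add, Multiset.card_replicate, cycleType_def, Multiset.card_map]
  congr 1
  · simp
  · rw [Nat.card_eq_fintype_card, Fintype.card_subtype_compl, Fintype.card_coe]

lemma card_colour_two {α : Type*} [Fintype α] [DecidableEq α] (f g : Perm α) (l : ℕ)
    (hf : f * f = 1) (hg : g * g = 1) (hf' : ∀ x, f x ≠ x) (hg' : ∀ x, g x ≠ x)
    (hl : (f * g).partition.parts.card = 2 * l) :
    Nat.card {S : α → Bool // (∀ x, S (f x) = !S x) ∧ (∀ x, S (g x) = !S x)} = 2 ^ l := by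
  have hff : ∀ x, f (f x) = x := fun x => by rw [← Perm.mul_apply, hf]; rfl
  have hgg : ∀ x, g (g x) = x := fun x => by rw [← Perm.mul_apply, hg]; rfl
  have hfi : f⁻¹ = f := inv_eq_of_mul_eq_one_left hf
  have hgi : g⁻¹ = g := inv_eq_of_mul_eq_one_left hg
  have hconj : f * (f * g) * f⁻¹ = (f * g)⁻¹ := by
    rw [mul_inv_rev, hfi, hgi, ← mul_assoc, hf, one_mul]
  have hpow : ∀ k : ℤ, f * (f * g) ^ k = (f * g) ^ (-k) * f := by
    intro k
    rw [zpow_neg, ← inv_zpow, ← hconj, conj_zpow]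
    simp
  let σ := f * g
  let i : Quotient (SameCycle.setoid σ) → Quotient (SameCycle.setoid σ) :=
    Quotient.map f (by
      rintro x y ⟨k, hk⟩
      refine ⟨-k, ?_⟩
      rw [← hk, ← Perm.mul_apply, ← Perm.mul_apply]
      exact congrArg (fun e : Perm α => e x) (hpow k).symm)
  obtain ⟨r, hr, hr'⟩ := card_colour i
    (by
      intro q
      induction q using Quotient.inductionOn with
      | h x => exact congrArg (Quotient.mk _) (hff x))
    (by
      intro q
      induction q using Quotient.inductionOn with
      | h x =>
        intro h
        obtain ⟨k, hk⟩ : σ.SameCycle (f x) x := Quotient.exact h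
        have h1 : (f * σ ^ (-k)) x = x := by
          rw [hpow]; simpa using hk
        obtain ⟨j, hj | hj⟩ := Int.even_or_odd' (-k)
        · have : f * σ ^ (-k) = σ ^ (-j) * f * σ ^ j := by
            rw [hj, two_mul, zpow_add, ← mul_assoc, hpow]
          rw [this] at h1
          apply hf' ((σ ^ j) x)
          apply (σ ^ (-j)).injective
          simpa using h1
        · have : f * σ ^ (-k) = σ ^ (-j) * g * σ ^ j := by
            have hgs : g = f * σ := by simp only [σ]; rw [← mul_assoc, hf, one_mul]
            rw [hj, hgs, ← mul_assoc, ← hpow]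
            simp only [mul_assoc]
            congr 1
            rw [← zpow_one_add, ← zpow_add]; congr 1; ring
          rw [this] at h1
          apply hg' ((σ ^ j) x)
          apply (σ ^ (-j)).injective
          simpa using h1)
  rw [card_cycles, hl] at hr
  have : l = r := by omega
  subst this
  rw [← hr']
  refine Nat.card_congr
    { toFun := fun S => ⟨fun q => Quotient.lift S.1 ?_ q, ?_⟩
      invFun := fun T => ⟨fun x => T.1 (Quotient.mk _ x), ?_, ?_⟩
      left_inv := ?_
      right_inv := ?_ }
  · rintro x y ⟨k, hk⟩
    rw [← hk]
    have h0 : ∀ z, S.1 (σ z) = S.1 z := fun z => by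
      simp only [σ, Perm.mul_apply]; rw [S.2.1, S.2.2, Bool.not_not]
    clear hk
    induction k with
    | zero => simp
    | succ k ih => rw [add_comm, zpow_one_add, Perm.mul_apply, h0]; exact ih
    | pred k ih =>
      rw [ih, ← h0 ((σ ^ (-(k : ℤ) - 1)) x), ← Perm.mul_apply, ← zpow_one_add]
      rw [show 1 + (-(k : ℤ) - 1) = -k by ring]
  · intro q
    induction q using Quotient.inductionOn with
    | h x => exact S.2.1 x
  · intro x
    exact T.2 (Quotient.mk _ x)
  · intro x
    have := T.2 (Quotient.mk _ (σ x))
    have h2 : i (Quotient.mk _ (σ x)) = Quotient.mk _ (g x) := by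
      change Quotient.mk _ (f (f (g x))) = _
      rw [hff]
    have h3 : (Quotient.mk _ (σ x) : Quotient (SameCycle.setoid σ)) = Quotient.mk _ x :=
      Quotient.sound (show σ.SameCycle _ _ from sameCycle_apply_left.2 (SameCycle.refl _ _))
    rw [h2, h3] at this
    exact this
  · intro S; rfl
  · rintro ⟨T, hT⟩
    apply Subtype.ext
    funext q
    induction q using Quotient.inductionOn with
    | h x => rfl

lemma parts_eq {N : ℕ} (μ : Nat.Partition N) :
    μ.parts = μ.parts.filter (2 ≤ ·) + Multiset.replicate (N - (μ.parts.filter (2 ≤ ·)).sum) 1 := by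
  have h1 : μ.parts.filter (¬ 2 ≤ ·) = Multiset.replicate (μ.parts.filter (¬ 2 ≤ ·)).card 1 := by
    rw [Multiset.eq_replicate]
    refine ⟨rfl, fun b hb => ?_⟩
    rw [Multiset.mem_filter] at hb
    have := μ.parts_pos hb.1
    omega
  have h2 := Multiset.filter_add_not (2 ≤ ·) μ.parts
  have h3 := congrArg Multiset.sum h2
  rw [Multiset.sum_add, μ.parts_sum, h1, Multiset.sum_replicate] at h3
  simp only [smul_eq_mul, mul_one] at h3
  conv_lhs => rw [← h2, h1]
  congr 2
  omega

lemma partition_iff {α : Type*} [Fintype α] [DecidableEq α] (σ : Perm α) (μ : Multiset ℕ)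
    (h0 : ∀ i ∈ μ, 0 < i) (hs : μ.sum = Fintype.card α) :
    σ.partition.parts = μ ↔ σ.cycleType = μ.filter (2 ≤ ·) := by
  constructor
  · intro h
    rw [← filter_parts_partition_eq_cycleType, h]
  · intro h
    have := parts_eq (⟨μ, fun {i} hi => h0 i hi, hs⟩ : Nat.Partition (Fintype.card α))
    dsimp only at this
    rw [this, parts_partition, ← h, sum_cycleType]

lemma card_class {n : ℕ} (lam : Nat.Partition n) :
    Nat.card {τ : Perm (Fin n) // τ.cycleType = lam.parts.filter (2 ≤ ·)} * zPart lam.parts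
      = n.factorial := by
  have h := card_of_cycleType_mul_eq (Fin n) (lam.parts.filter (2 ≤ ·))
  have hp := parts_eq lam
  set m := lam.parts.filter (2 ≤ ·) with hm
  have h2 : ∀ a ∈ m, 2 ≤ a := fun a ha => (Multiset.mem_filter.1 ha).2
  have hle : m.sum ≤ n := by
    have := congrArg Multiset.sum hp
    rw [lam.parts_sum, Multiset.sum_add] at this
    omega
  rw [if_pos ⟨by simpa using hle, h2⟩] at h
  simp only [Fintype.card_fin] at h
  rw [Nat.card_eq_fintype_card, Fintype.card_subtype, ← h]
  congr 1
  rw [hp]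
  set k := n - m.sum
  have h1m : 1 ∉ m := fun h => by have := h2 1 h; omega
  have hz : zPart (m + Multiset.replicate k 1) =
      ∏ i ∈ insert 1 m.toFinset, (i ^ (m + Multiset.replicate k 1).count i *
        Nat.factorial ((m + Multiset.replicate k 1).count i)) := by
    unfold zPart
    apply Finset.prod_subset
    · intro i hi
      simp only [Multiset.mem_toFinset, Multiset.mem_add, Multiset.mem_replicate] at hi
      simp only [Finset.mem_insert, Multiset.mem_toFinset]
      tauto
    · intro i _ hi
      rw [Multiset.mem_toFinset] at hi
      rw [Multiset.count_eq_zero_of_notMem hi]; simp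
  rw [hz, Finset.prod_insert (by simpa using h1m)]
  have h1 : (m + Multiset.replicate k 1).count 1 = k := by
    rw [Multiset.count_add, Multiset.count_eq_zero_of_notMem h1m, Multiset.count_replicate_self,
      zero_add]
  rw [h1, one_pow, one_mul, mul_assoc]
  congr 1
  rw [Finset.prod_multiset_count, ← Finset.prod_mul_distrib]
  apply Finset.prod_congr rfl
  intro i hi
  have hi1 : i ≠ 1 := fun h => h1m (by rw [h] at hi; exact Multiset.mem_toFinset.1 hi)
  have : (m + Multiset.replicate k 1).count i = m.count i := by
    rw [Multiset.count_add, Multiset.count_replicate, if_neg (Ne.symm hi1), add_zero]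
  rw [this]

/-- untwisting permutation of a colouring -/
lemma exists_phi {α : Type*} [Finite α] (S : α × Bool → Bool) (hS : ∀ y, S (F α y) = !S y) :
    ∃ φ : Perm (α × Bool), (∀ y, (φ y).2 = S y) ∧ φ * F α = F α * φ := by
  have h1 : ∀ x c, S (x, !c) = !S (x, c) := fun x c => hS (x, c)
  have inj : Function.Injective (fun y : α × Bool => (y.1, S y)) := by
    rintro ⟨x, c⟩ ⟨x', c'⟩ h
    simp only [Prod.mk.injEq] at h
    obtain ⟨rfl, h⟩ := h
    have h2 : S (x, true) = !S (x, false) := h1 x false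
    clear h1 hS
    cases c <;> cases c' <;> first | rfl | (exfalso; rw [h2] at h; revert h; cases S (x, false) <;> decide)
  refine ⟨Equiv.ofBijective _ (Finite.injective_iff_bijective.1 inj), fun y => rfl, ?_⟩
  ext1 ⟨x, c⟩
  exact Prod.ext rfl (h1 x c)

lemma card_fiber {α : Type*} [Fintype α] [DecidableEq α] (m : Multiset ℕ)
    (S S' : α × Bool → Bool) (hS : ∀ y, S (F α y) = !S y) (hS' : ∀ y, S' (F α y) = !S' y) :
    Nat.card {w : Perm (α × Bool) // (F α * w * F α * w⁻¹).cycleType = m + m ∧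
      ∀ y, S (w y) = S' y} =
    (Fintype.card α).factorial * Nat.card {τ : Perm α // τ.cycleType = m} := by
  obtain ⟨φ, hφ, hφF⟩ := exists_phi S hS
  obtain ⟨ψ, hψ, hψF⟩ := exists_phi S' hS'
  have key : ∀ p, (F α * (φ⁻¹ * D p * ψ) * F α * (φ⁻¹ * D p * ψ)⁻¹).cycleType =
      (p true * (p false)⁻¹).cycleType + (p true * (p false)⁻¹).cycleType := by
    intro p
    rw [← F_D, ← cycleType_conj (τ := φ)]
    congr 1
    have h1 : F α * φ⁻¹ = φ⁻¹ * F α := by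
      rw [eq_inv_mul_iff_mul_eq, ← mul_assoc, hφF, mul_assoc, mul_inv_cancel, mul_one]
    calc _ = φ * (F α * φ⁻¹) * D p * (ψ * F α) * ψ⁻¹ * (D p)⁻¹ * (φ * φ⁻¹) := by group
      _ = _ := by rw [h1, hψF]; group
  have mm : ∀ a b : Multiset ℕ, a + a = b + b → a = b := by
    intro a b h
    ext x
    have := congrArg (Multiset.count x) h
    simp only [Multiset.count_add] at this
    omega
  let E : {q : Perm α × Perm α // q.2.cycleType = m} →
      {w : Perm (α × Bool) // (F α * w * F α * w⁻¹).cycleType = m + m ∧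
      ∀ y, S (w y) = S' y} := fun q =>
    ⟨φ⁻¹ * D (fun c => if c then q.1.2 * q.1.1 else q.1.1) * ψ, by
      rw [key]; simp [q.2], by
      intro y
      rw [← hφ, ← hψ, mul_assoc, Perm.mul_apply, pp_inv, Perm.mul_apply]
      rfl⟩
  have hE : Function.Bijective E := by
    constructor
    · rintro ⟨⟨a, b⟩, h⟩ ⟨⟨a', b'⟩, h'⟩ he
      have he := congrArg Subtype.val he
      simp only [E] at he
      have he := D_inj (mul_left_cancel (mul_right_cancel he))
      have h1 := congrFun he false
      have h2 := congrFun he true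
      simp at h1 h2
      subst h1
      have h2 := mul_right_cancel h2
      subst h2
      rfl
    · rintro ⟨w, hw, hc⟩
      obtain ⟨p, hp⟩ := exists_D (φ * w * ψ⁻¹) (by
        intro y
        rw [mul_assoc, Perm.mul_apply, hφ, Perm.mul_apply, hc, ← hψ, pp_inv])
      have hwp : w = φ⁻¹ * D p * ψ := by rw [hp]; group
      subst hwp
      rw [key] at hw
      refine ⟨⟨(p false, p true * (p false)⁻¹), mm _ _ hw⟩, ?_⟩
      apply Subtype.ext
      simp only [E]
      congr 3
      funext c
      cases c <;> simp
  rw [← Nat.card_congr (Equiv.ofBijective E hE)]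
  have e2 : {q : Perm α × Perm α // q.2.cycleType = m} ≃ Perm α × {τ : Perm α // τ.cycleType = m} :=
    { toFun := fun q => (q.1.1, ⟨q.1.2, q.2⟩)
      invFun := fun q => ⟨(q.1, q.2.1), q.2.2⟩
      left_inv := fun _ => rfl
      right_inv := fun _ => rfl }
  rw [Nat.card_congr e2, Nat.card_prod, Nat.card_eq_fintype_card, Fintype.card_perm]

lemma main_count {n : ℕ} (lam : Nat.Partition n) :
    Nat.card {w : Perm (Fin n × Bool) // (F (Fin n) * w * F (Fin n) * w⁻¹).cycleType =
      lam.parts.filter (2 ≤ ·) + lam.parts.filter (2 ≤ ·)} * 2 ^ lam.parts.card =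
    (2 ^ n * 2 ^ n) * (n.factorial *
      Nat.card {τ : Perm (Fin n) // τ.cycleType = lam.parts.filter (2 ≤ ·)}) := by
  set m := lam.parts.filter (2 ≤ ·) with hm
  let f := F (Fin n)
  have hff : f * f = 1 := F_mul_F
  have hffx : ∀ x, f (f x) = x := fun x => by rw [← Perm.mul_apply, hff]; rfl
  have hf' : ∀ x, f x ≠ x := by
    rintro ⟨x, c⟩ h
    have := (Prod.ext_iff.1 h).2
    cases c <;> simp [f, F_apply] at this
  let K := {w : Perm (Fin n × Bool) // (f * w * f * w⁻¹).cycleType = m + m}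
  let T := {S : Fin n × Bool → Bool // ∀ y, S (f y) = !S y}
  have hT : Nat.card T = 2 ^ n := by
    obtain ⟨r, h1, h2⟩ := card_colour f hffx hf'
    have : n = r := by simp at h1; omega
    rw [this]; exact this ▸ h2
  let A := (w : K) × {S : Fin n × Bool → Bool //
    (∀ x, S (f x) = !S x) ∧ (∀ x, S ((w.1 * f * w.1⁻¹) x) = !S x)}
  let B := (s : T × T) × {w : Perm (Fin n × Bool) // (f * w * f * w⁻¹).cycleType = m + m ∧
      ∀ y, s.1.1 (w y) = s.2.1 y}
  have hA : Nat.card A = Nat.card K * 2 ^ lam.parts.card := by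
    simp only [A]
    rw [Nat.card_sigma, Finset.sum_congr rfl (g := fun _ => 2 ^ lam.parts.card)]
    · simp [Nat.card_eq_fintype_card]
    · rintro ⟨w, hw⟩ _
      apply card_colour_two _ _ _ hff
      · have : w * f * w⁻¹ * (w * f * w⁻¹) = w * (f * f) * w⁻¹ := by group
        rw [this, hff]; group
      · exact hf'
      · intro x h
        apply hf' (w⁻¹ x)
        apply w.injective
        simpa using h
      · have h2 : (f * (w * f * w⁻¹)).partition.parts = lam.parts + lam.parts := by
          rw [partition_iff]
          · rw [Multiset.filter_add, ← hw]; congr 1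
          · intro i hi
            rw [Multiset.mem_add, or_self] at hi
            exact lam.parts_pos hi
          · rw [Multiset.sum_add, lam.parts_sum]; simp [mul_two]
        rw [h2, Multiset.card_add, two_mul]
  have hB : Nat.card B = (2 ^ n * 2 ^ n) * (n.factorial *
      Nat.card {τ : Perm (Fin n) // τ.cycleType = m}) := by
    simp only [B]
    rw [Nat.card_sigma, Finset.sum_congr rfl (g := fun _ => n.factorial *
      Nat.card {τ : Perm (Fin n) // τ.cycleType = m})]
    · rw [Finset.sum_const, Finset.card_univ, ← Nat.card_eq_fintype_card, Nat.card_prod, hT,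
        smul_eq_mul]
    · rintro ⟨s, t⟩ _
      have := card_fiber m s.1 t.1 s.2 t.2
      rw [Fintype.card_fin] at this
      exact this
  change Nat.card K * _ = _
  rw [← hA, ← hB]
  refine Nat.card_congr
    { toFun := fun a => ⟨(⟨a.2.1, a.2.2.1⟩, ⟨fun y => a.2.1 (a.1.1 y), fun y => ?_⟩),
        ⟨a.1.1, a.1.2, fun y => rfl⟩⟩
      invFun := fun b => ⟨⟨b.2.1, b.2.2.1⟩, ⟨b.1.1.1, b.1.1.2, fun x => ?_⟩⟩
      left_inv := fun a => rfl
      right_inv := ?_ }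
  · have := a.2.2.2 (a.1.1 y)
    simpa using this
  · have h1 := b.2.2.2
    have h2 := b.1.2.2 (b.2.1⁻¹ x)
    rw [← h1, ← h1] at h2
    simpa using h2
  · rintro ⟨⟨⟨s, hs⟩, ⟨t, ht⟩⟩, ⟨w, hw, hc⟩⟩
    have : t = fun y => s (w y) := funext fun y => (hc y).symm
    subst this
    rfl

end KLam

/-- the double coset `K_λ = {ω ∈ S_{2n} : f⋆ ω f⋆ ω⁻¹ has cycle type
(λ_1, λ_1, …, λ_p, λ_p)}` of the hyperoctahedral group `B_n` (the centralizer of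
`f⋆`, of order `2^n n!`) has cardinality `|B_n|² / (2^{ℓ(λ)} z_λ)`. -/
theorem stmt17 (n : ℕ) (hn : 1 ≤ n) (lam : Nat.Partition n) :
    (Nat.card {ω : Equiv.Perm (Fin (2 * n)) //
        (fstar n * ω * fstar n * ω⁻¹).partition.parts = lam.parts + lam.parts} : ℚ)
      = ((2 ^ n * Nat.factorial n : ℚ)) ^ 2 /
          (2 ^ lam.parts.card * (zPart lam.parts : ℚ)) := by
  classical
  let e : Fin (2 * n) ≃ Fin n × Bool :=
    { toFun := fun k => (⟨k.1 / 2, by omega⟩, decide (k.1 % 2 = 1))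
      invFun := fun y => ⟨2 * y.1.1 + (if y.2 then 1 else 0), by
        have := y.1.2
        split_ifs <;> omega⟩
      left_inv := by
        intro k
        apply Fin.ext
        simp only [decide_eq_true_eq]
        split_ifs <;> omega
      right_inv := by
        rintro ⟨x, c⟩
        cases c <;> simp [Fin.ext_iff] <;> omega }
  have hef : e.permCongr (fstar n) = KLam.F (Fin n) := by
    ext1 y
    obtain ⟨k, rfl⟩ := e.surjective y
    rw [Equiv.permCongr_apply, Equiv.symm_apply_apply]
    change ((⟨_, _⟩ : Fin n), decide _) = ((⟨_, _⟩ : Fin n), !decide _)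
    simp only [fstar, Function.Involutive.coe_toPerm, fstarFun]
    rcases Nat.mod_two_eq_zero_or_one k.1 with h | h
    · simp [h]; omega
    · simp [h]; omega
  have hcong : Nat.card {ω : Equiv.Perm (Fin (2 * n)) //
        (fstar n * ω * fstar n * ω⁻¹).partition.parts = lam.parts + lam.parts} =
      Nat.card {w : Equiv.Perm (Fin n × Bool) //
        (KLam.F (Fin n) * w * KLam.F (Fin n) * w⁻¹).cycleType =
      lam.parts.filter (2 ≤ ·) + lam.parts.filter (2 ≤ ·)} := by
    apply Nat.card_congr
    refine Equiv.subtypeEquiv e.permCongr ?_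
    intro ω
    rw [KLam.partition_iff]
    · rw [Multiset.filter_add]
      have : KLam.F (Fin n) * e.permCongr ω * KLam.F (Fin n) * (e.permCongr ω)⁻¹ =
          e.permCongr (fstar n * ω * fstar n * ω⁻¹) := by
        rw [← hef]
        ext1 y
        have hinv : (e.permCongr ω)⁻¹ = e.permCongr ω⁻¹ := rfl
        rw [hinv]
        simp [Equiv.permCongr_apply]
      rw [this]
      have hct : ∀ σ : Equiv.Perm (Fin (2 * n)), (e.permCongr σ).cycleType = σ.cycleType := by
        intro σ
        let e' : Fin (2 * n) ≃ Subtype (fun _ : Fin n × Bool => True) :=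
          e.trans (Equiv.subtypeUnivEquiv (fun _ => trivial)).symm
        rw [← Equiv.Perm.cycleType_extendDomain e' (g := σ)]
        congr 1
      rw [hct]
    · intro i hi
      rw [Multiset.mem_add, or_self] at hi
      exact lam.parts_pos hi
    · rw [Multiset.sum_add, lam.parts_sum]; simp [two_mul]
  have h1 := KLam.main_count lam
  have h2 := KLam.card_class lam
  rw [← hcong] at h1
  have hz : zPart lam.parts ≠ 0 := by
    intro h
    rw [h, mul_zero] at h2
    exact (Nat.factorial_ne_zero n) h2.symm
  have hz' : (zPart lam.parts : ℚ) ≠ 0 := by exact_mod_cast hz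
  rw [eq_div_iff (by positivity)]
  have h1' := congrArg (Nat.cast : ℕ → ℚ) h1
  have h2' := congrArg (Nat.cast : ℕ → ℚ) h2
  push_cast at h1' h2'
  rw [← mul_assoc, h1']
  linear_combination (2 ^ n * 2 ^ n * (n.factorial : ℚ)) * h2'
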